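/- arXiv:1611.03564 — 2 statements merged into one kernel-verified Lean document; each statement's English description precedes it below -/
import Mathlib

section
/- There exists a finite constant C such that for every r ≥ 1 and every y ∈ ℍ¹, (1/σ(∂B₁)) ∫_{∂B₁} ρ( y⁻¹ · δ_r(ξ) )⁻¹ dσ(ξ) ≤ C/r. Consequently, if f ∈ L¹(ℍ¹, dv), then the average over the Korányi sphere of radius r of the quantity bounding |∇_b v| for v(x) := ∫_{ℍ¹} log( ρ(y)/ρ(y⁻¹x) ) f(y) dv(y) satisfies (1/σ(∂B₁)) ∫_{∂B₁} ∫_{ℍ¹} |f(y)| ρ( y⁻¹ · δ_r(ξ) )⁻¹ dv(y) dσ(ξ) ≤ C‖f‖_{L¹} / r; i.e., the spherical average of |∇_b v| over ∂B_r is O(1/r) as r → ∞. -/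
open MeasureTheory Real

noncomputable section

/-- The Heisenberg group `ℍ¹` as `ℝ³` with coordinates `(x, y, t)`. -/
abbrev Heis : Type := ℝ × ℝ × ℝ

/-- Group law `(z,t)·(z',t') = (z+z', t+t'+2 Im(z ⬝ conj z'))`. -/
def Hmul (p q : Heis) : Heis :=
  (p.1 + q.1, p.2.1 + q.2.1, p.2.2 + q.2.2 + 2 * (p.2.1 * q.1 - p.1 * q.2.1))

/-- Group inverse `(z,t)⁻¹ = (-z,-t)`. -/
def Hinv (p : Heis) : Heis := (-p.1, -p.2.1, -p.2.2)

/-- Korányi norm `ρ(z,t) = (|z|⁴ + t²)^(1/4)`. -/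
def rho (p : Heis) : ℝ := ((p.1 ^ 2 + p.2.1 ^ 2) ^ 2 + p.2.2 ^ 2) ^ ((1 : ℝ) / 4)

/-- Korányi ball `B(p,r) = {q : ρ(p⁻¹ q) < r}`. -/
def Kball (p : Heis) (r : ℝ) : Set Heis := {q | rho (Hmul (Hinv p) q) < r}

/-- The left-invariant vector field `X = ∂ₓ + 2y ∂_t` acting on a function. -/
def Xd (f : Heis → ℝ) (p : Heis) : ℝ := fderiv ℝ f p (1, 0, 2 * p.2.1)

/-- The left-invariant vector field `Y = ∂_y − 2x ∂_t` acting on a function. -/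
def Yd (f : Heis → ℝ) (p : Heis) : ℝ := fderiv ℝ f p (0, 1, -(2 * p.1))

/-- The vector field `T = ∂_t`. -/
def Td (f : Heis → ℝ) (p : Heis) : ℝ := fderiv ℝ f p (0, 0, 1)

/-- Sub-Laplacian `Δ_b = X² + Y²`. -/
def subLap (f : Heis → ℝ) : Heis → ℝ := fun p => Xd (Xd f) p + Yd (Yd f) p

/-- Squared length of the horizontal gradient: `|∇_b f|² = (Xf)² + (Yf)²`. -/
def gradb2 (f : Heis → ℝ) (p : Heis) : ℝ := (Xd f p) ^ 2 + (Yd f p) ^ 2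

/-- The open unit disk in the `(x₁,x₂)`-plane. -/
def unitDisk : Set (ℝ × ℝ) := {v | v.1 ^ 2 + v.2 ^ 2 < 1}

/-- `g(x₁,x₂) = √(1 − (x₁²+x₂²)²)`, whose graphs are the two halves of the Korányi
unit sphere. -/
def gcap (v : ℝ × ℝ) : ℝ := Real.sqrt (1 - (v.1 ^ 2 + v.2 ^ 2) ^ 2)

/-- Area density `√((∂_{x₁}u − x₂)² + (∂_{x₂}u + x₁)²)` of the graph of `u`. -/
def graphDens (u : ℝ × ℝ → ℝ) (v : ℝ × ℝ) : ℝ :=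
  Real.sqrt ((fderiv ℝ u v (1, 0) - v.2) ^ 2 + (fderiv ℝ u v (0, 1) + v.1) ^ 2)

/-- The surface measure `σ` on the Korányi unit sphere `∂B₁ = {ρ = 1}`: the sum of the
pushforwards, under the two graph maps `(x₁,x₂) ↦ (x₁,x₂,±g)`, of the corresponding
area densities on the unit disk. -/
def sigmaSphere : Measure Heis :=
  Measure.map (fun v : ℝ × ℝ => (v.1, v.2, gcap v))
      ((volume.restrict unitDisk).withDensity fun v => ENNReal.ofReal (graphDens gcap v))
    + Measure.map (fun v : ℝ × ℝ => (v.1, v.2, -gcap v))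
      ((volume.restrict unitDisk).withDensity
        fun v => ENNReal.ofReal (graphDens (fun w => -gcap w) v))

/-- Heisenberg dilation `δ_r(z,t) = (rz, r²t)`. -/
def Hdil (r : ℝ) (p : Heis) : Heis := (r * p.1, r * p.2.1, r ^ 2 * p.2.2)

/-- The singular weight `|x - b| ^ (-β)`, equal to `∞` at `x = b` when `β > 0`. -/
def powSing (β b x : ℝ) : ENNReal := ENNReal.ofReal |x - b| ^ (-β)

lemma measurable_powSing {α : Type*} [MeasurableSpace α] (β : ℝ) {b x : α → ℝ}
    (hb : Measurable b) (hx : Measurable x) :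
    Measurable fun v => powSing β (b v) (x v) := by
  unfold powSing
  fun_prop

lemma rpow_neg_anti {β : ℝ} (hβ : 0 ≤ β) {a b : ENNReal} (h : a ≤ b) :
    b ^ (-β) ≤ a ^ (-β) := by
  rw [ENNReal.rpow_neg, ENNReal.rpow_neg]
  exact ENNReal.inv_le_inv.2 (ENNReal.rpow_le_rpow h hβ)

lemma rpow_neg_mul_rpow_neg_le {α β : ℝ} (hα : 0 < α) (hβ : 0 < β) {a b : ENNReal}
    (ha : a ≠ ⊤) (hb : b ≠ ⊤) :
    a ^ (-α) * b ^ (-β) ≤ a ^ (-(α + β)) + b ^ (-(α + β)) := by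
  have key : ∀ m : ENNReal, m ≠ ⊤ → m ^ (-α) * m ^ (-β) ≤ m ^ (-(α + β)) := by
    intro m hm
    rcases eq_or_ne m 0 with rfl | h0
    · rw [ENNReal.zero_rpow_of_neg (y := -(α + β)) (by linarith)]
      exact le_top
    · rw [← ENNReal.rpow_add _ _ h0 hm, neg_add]
  rcases le_total a b with h | h
  · exact (mul_le_mul_right (rpow_neg_anti hβ.le h) _).trans
      ((key a ha).trans le_self_add)
  · exact (mul_le_mul_left (rpow_neg_anti hα.le h) _).trans
      ((key b hb).trans le_add_self)

lemma powSing_mul_powSing_le {α β γ : ℝ} (hα : 0 < α) (hβ : 0 < β) (hγ : α + β = γ)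
    (a b x : ℝ) :
    powSing α a x * powSing β b x ≤ powSing γ a x + powSing γ b x := by
  subst hγ
  exact rpow_neg_mul_rpow_neg_le hα hβ ENNReal.ofReal_ne_top ENNReal.ofReal_ne_top

lemma lintegral_powSing_zero_lt_top {β : ℝ} (hβ : β < 1) :
    ∫⁻ x in Set.Ioo (-1 : ℝ) 1, powSing β 0 x < ⊤ := by
  have hi : IntegrableOn (fun x : ℝ => |x| ^ (-β)) (Set.Ioo (-1 : ℝ) 1) := by
    have h1 : IntervalIntegrable (fun x : ℝ => x ^ (-β)) volume 0 1 :=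
      intervalIntegral.intervalIntegrable_rpow' (by linarith)
    have h1' : IntervalIntegrable (fun x : ℝ => |x| ^ (-β)) volume 0 1 := by
      refine h1.congr ?_
      intro x hx
      rw [Set.uIoc_of_le zero_le_one] at hx
      simp [abs_of_pos hx.1]
    have h2 : IntervalIntegrable (fun x : ℝ => |x| ^ (-β)) volume (-1) 0 := by
      have := (IntervalIntegrable.iff_comp_neg (f := fun x : ℝ => |x| ^ (-β))
        (a := 0) (b := 1)).1 h1'
      simpa using this.symm
    have h3 := (h2.trans h1').1
    exact h3.mono_set Set.Ioo_subset_Ioc_self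
  have h := hi.lintegral_lt_top
  refine lt_of_eq_of_lt (lintegral_congr_ae ?_) h
  have hne : ∀ᵐ x : ℝ ∂(volume.restrict (Set.Ioo (-1 : ℝ) 1)), x ≠ 0 :=
    ae_restrict_of_ae (by simp [ae_iff, measure_singleton])
  filter_upwards [hne] with x hx
  rw [powSing, sub_zero, ENNReal.ofReal_rpow_of_pos (abs_pos.2 hx)]

lemma exists_lintegral_powSing_le {β : ℝ} (hβ0 : 0 < β) (hβ : β < 1) :
    ∃ K : ENNReal, K ≠ ⊤ ∧ ∀ b : ℝ, ∫⁻ x in Set.Icc (-1 : ℝ) 1, powSing β b x ≤ K := by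
  refine ⟨2 + ∫⁻ x in Set.Ioo (-1 : ℝ) 1, powSing β 0 x,
    ENNReal.add_ne_top.2 ⟨by simp, (lintegral_powSing_zero_lt_top hβ).ne⟩, fun b => ?_⟩
  set h : ℝ → ENNReal := (Set.Ioo (-1 : ℝ) 1).indicator (powSing β 0) with hh
  have hle : ∀ x, powSing β b x ≤ 1 + h (x - b) := by
    intro x
    by_cases hx : x - b ∈ Set.Ioo (-1 : ℝ) 1
    · rw [hh, Set.indicator_of_mem hx]
      simp [powSing]
    · refine le_trans ?_ le_self_add
      have h1 : (1 : ENNReal) ≤ ENNReal.ofReal |x - b| := by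
        rw [← ENNReal.ofReal_one]
        refine ENNReal.ofReal_le_ofReal ?_
        by_contra! hlt
        exact hx (abs_lt.1 hlt)
      simpa [powSing] using rpow_neg_anti hβ0.le h1
  calc ∫⁻ x in Set.Icc (-1 : ℝ) 1, powSing β b x
      ≤ ∫⁻ x in Set.Icc (-1 : ℝ) 1, (1 + h (x - b)) := lintegral_mono hle
    _ = (∫⁻ _ in Set.Icc (-1 : ℝ) 1, 1) + ∫⁻ x in Set.Icc (-1 : ℝ) 1, h (x - b) :=
        lintegral_add_left measurable_const _
    _ ≤ 2 + ∫⁻ x, h (x - b) := by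
        refine add_le_add ?_ (setLIntegral_le_lintegral _ _)
        simp only [lintegral_const, one_mul, Measure.restrict_apply_univ, Real.volume_Icc]
        norm_num
    _ = _ := by
        rw [lintegral_sub_right_eq_self h b, hh, lintegral_indicator measurableSet_Ioo]

lemma lintegral_four_powSing_le {β : ℝ} {K : ENNReal}
    (h : ∀ b : ℝ, ∫⁻ x in Set.Icc (-1 : ℝ) 1, powSing β b x ≤ K) (a b c d : ℝ) :
    ∫⁻ x in Set.Icc (-1 : ℝ) 1, (powSing β a x + powSing β b x +
      (powSing β c x + powSing β d x)) ≤ K + K + (K + K) := by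
  have hm : ∀ e, Measurable fun x => powSing β e x := fun e =>
    measurable_powSing β measurable_const measurable_id
  rw [lintegral_add_left ((hm a).fun_add (hm b)), lintegral_add_left (hm a),
    lintegral_add_left (hm c)]
  exact add_le_add (add_le_add (h a) (h b)) (add_le_add (h c) (h d))

lemma rpow_neg_le_add_of_min {β : ℝ} (hβ : 0 ≤ β) {a b c : ENNReal} (h : min a b ≤ c) :
    c ^ (-β) ≤ a ^ (-β) + b ^ (-β) := by
  rcases min_le_iff.1 h with h | h
  · exact (rpow_neg_anti hβ h).trans le_self_add
  · exact (rpow_neg_anti hβ h).trans le_add_self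

/-- On the unit disk, the boundary singularity `(1 - |x|²) ^ (-1/2)` is dominated by products
of one-dimensional singularities. -/
lemma disk_weight_le {v : ℝ × ℝ} (hv : v ∈ unitDisk) :
    ENNReal.ofReal (1 - (v.1 ^ 2 + v.2 ^ 2)) ^ (-(1 / 2) : ℝ) ≤
      (powSing (1 / 4) 1 v.2 + powSing (1 / 4) (-1) v.2) *
        (powSing (1 / 2) √(1 - v.2 ^ 2) v.1 + powSing (1 / 2) (-√(1 - v.2 ^ 2)) v.1) := by
  obtain ⟨x, y⟩ := v
  simp only [unitDisk, Set.mem_ofPred_eq] at hv ⊢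
  set c := √(1 - y ^ 2) with hc
  have hc2 : c ^ 2 = 1 - y ^ 2 := Real.sq_sqrt (by nlinarith)
  have hc0 : 0 < c := Real.sqrt_pos.2 (by nlinarith)
  have hx : |x| < c := abs_lt_of_sq_lt_sq (by nlinarith) hc0.le
  have hy : |y| < 1 := abs_lt_of_sq_lt_sq (by nlinarith) zero_le_one
  obtain ⟨hx1, hx2⟩ := abs_lt.1 hx
  obtain ⟨hy1, hy2⟩ := abs_lt.1 hy
  set m := min |x - c| |x - -c| with hm
  have e1 : |x - c| = c - x := by rw [abs_of_neg (by linarith)]; ring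
  have e2 : |x - -c| = x + c := by rw [abs_of_pos (by linarith)]; ring
  have e3 : |y - 1| = 1 - y := by rw [abs_of_neg (by linarith)]; ring
  have e4 : |y - -1| = y + 1 := by rw [abs_of_pos (by linarith)]; ring
  have hm0 : 0 < m := by rw [hm, e1, e2]; exact lt_min (by linarith) (by linarith)
  have hcm : c * m ≤ 1 - (x ^ 2 + y ^ 2) := by
    have : 1 - (x ^ 2 + y ^ 2) = (c - x) * (x + c) := by nlinarith
    rw [this, hm, e1, e2]
    rcases le_total 0 x with h | h
    · rw [min_eq_left (by linarith)]; nlinarith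
    · rw [min_eq_right (by linarith)]; nlinarith
  have hcy : min |y - 1| |y - -1| ≤ c ^ 2 := by
    rw [hc2, e3, e4]
    rcases le_total 0 y with h | h
    · rw [min_eq_left (by linarith)]; nlinarith
    · rw [min_eq_right (by linarith)]; nlinarith
  have hA : ENNReal.ofReal c ^ (-(1 / 2) : ℝ) ≤
      powSing (1 / 4) 1 y + powSing (1 / 4) (-1) y := by
    have : ENNReal.ofReal c ^ (-(1 / 2) : ℝ) = ENNReal.ofReal (c ^ 2) ^ (-(1 / 4) : ℝ) := by
      rw [ENNReal.ofReal_pow hc0.le, ← ENNReal.rpow_natCast, ← ENNReal.rpow_mul]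
      norm_num
    rw [this]
    refine rpow_neg_le_add_of_min (by norm_num) ?_
    rw [← ENNReal.ofReal_min]
    exact ENNReal.ofReal_le_ofReal hcy
  have hB : ENNReal.ofReal m ^ (-(1 / 2) : ℝ) ≤
      powSing (1 / 2) c x + powSing (1 / 2) (-c) x := by
    refine rpow_neg_le_add_of_min (by norm_num) ?_
    rw [← ENNReal.ofReal_min]
  calc ENNReal.ofReal (1 - (x ^ 2 + y ^ 2)) ^ (-(1 / 2) : ℝ)
      ≤ ENNReal.ofReal (c * m) ^ (-(1 / 2) : ℝ) :=
        rpow_neg_anti (by norm_num) (ENNReal.ofReal_le_ofReal hcm)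
    _ = ENNReal.ofReal c ^ (-(1 / 2) : ℝ) * ENNReal.ofReal m ^ (-(1 / 2) : ℝ) := by
        rw [ENNReal.ofReal_mul hc0.le, ENNReal.mul_rpow_of_ne_top ENNReal.ofReal_ne_top
          ENNReal.ofReal_ne_top]
    _ ≤ _ := mul_le_mul' hA hB

lemma exists_lintegral_disk_le :
    ∃ K : ENNReal, K ≠ ⊤ ∧ ∀ a b : ℝ,
      ∫⁻ v in unitDisk, ENNReal.ofReal (1 - (v.1 ^ 2 + v.2 ^ 2)) ^ (-(1 / 2) : ℝ) *
        (powSing (1 / 3) a v.1 * powSing (2 / 3) b v.2) ≤ K := by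
  obtain ⟨K₁, hK₁, h₁⟩ := exists_lintegral_powSing_le (β := 5 / 6) (by norm_num) (by norm_num)
  obtain ⟨K₂, hK₂, h₂⟩ := exists_lintegral_powSing_le (β := 11 / 12) (by norm_num) (by norm_num)
  refine ⟨(K₂ + K₂ + (K₂ + K₂)) * (K₁ + K₁ + (K₁ + K₁)), by finiteness, fun a b => ?_⟩
  set F : ℝ → ENNReal := fun y =>
    powSing (11 / 12) 1 y + powSing (11 / 12) b y +
      (powSing (11 / 12) (-1) y + powSing (11 / 12) b y)
  set G : ℝ → ℝ → ENNReal := fun y x =>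
    powSing (5 / 6) √(1 - y ^ 2) x + powSing (5 / 6) a x +
      (powSing (5 / 6) (-√(1 - y ^ 2)) x + powSing (5 / 6) a x)
  have hpt : ∀ v ∈ unitDisk, ENNReal.ofReal (1 - (v.1 ^ 2 + v.2 ^ 2)) ^ (-(1 / 2) : ℝ) *
        (powSing (1 / 3) a v.1 * powSing (2 / 3) b v.2) ≤ F v.2 * G v.2 v.1 := by
    intro v hv
    calc _ ≤ ((powSing (1 / 4) 1 v.2 + powSing (1 / 4) (-1) v.2) *
        (powSing (1 / 2) √(1 - v.2 ^ 2) v.1 + powSing (1 / 2) (-√(1 - v.2 ^ 2)) v.1)) *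
          (powSing (1 / 3) a v.1 * powSing (2 / 3) b v.2) :=
          mul_le_mul' (disk_weight_le hv) le_rfl
      _ = (powSing (1 / 4) 1 v.2 * powSing (2 / 3) b v.2 +
            powSing (1 / 4) (-1) v.2 * powSing (2 / 3) b v.2) *
          (powSing (1 / 2) √(1 - v.2 ^ 2) v.1 * powSing (1 / 3) a v.1 +
            powSing (1 / 2) (-√(1 - v.2 ^ 2)) v.1 * powSing (1 / 3) a v.1) := by ring
      _ ≤ F v.2 * G v.2 v.1 := by
          refine mul_le_mul' (add_le_add ?_ ?_) (add_le_add ?_ ?_) <;>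
          exact powSing_mul_powSing_le (by norm_num) (by norm_num) (by norm_num) _ _ _
  have hmF : Measurable F := by
    have := fun c : ℝ => measurable_powSing (11 / 12) (measurable_const (a := c)) measurable_id
    exact ((this 1).add (this b)).add ((this (-1)).add (this b))
  have hmG : Measurable fun v : ℝ × ℝ => G v.2 v.1 := by
    have hc : Measurable fun v : ℝ × ℝ => √(1 - v.2 ^ 2) := by fun_prop
    have ha := measurable_powSing (5 / 6) (measurable_const (a := a))
      (measurable_fst (α := ℝ) (β := ℝ))
    exact ((measurable_powSing _ hc measurable_fst).add ha).add
      ((measurable_powSing _ hc.neg measurable_fst).add ha)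
  have hsub : unitDisk ⊆ Set.Icc (-1 : ℝ) 1 ×ˢ Set.Icc (-1 : ℝ) 1 := by
    rintro ⟨x, y⟩ hv
    simp only [unitDisk, Set.mem_ofPred_eq] at hv
    have hx : |x| ≤ 1 := abs_le_of_sq_le_sq (by nlinarith) zero_le_one
    have hy : |y| ≤ 1 := abs_le_of_sq_le_sq (by nlinarith) zero_le_one
    exact ⟨abs_le.1 hx, abs_le.1 hy⟩
  have hms : ∀ β c, Measurable (powSing β c) := fun β c =>
    measurable_powSing β measurable_const measurable_id
  calc _ ≤ ∫⁻ v in unitDisk, F v.2 * G v.2 v.1 :=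
        setLIntegral_mono ((hmF.comp measurable_snd).mul hmG) hpt
    _ ≤ ∫⁻ v in Set.Icc (-1 : ℝ) 1 ×ˢ Set.Icc (-1 : ℝ) 1, F v.2 * G v.2 v.1 :=
        lintegral_mono_set hsub
    _ = ∫⁻ y in Set.Icc (-1 : ℝ) 1, ∫⁻ x in Set.Icc (-1 : ℝ) 1, F y * G y x := by
        rw [Measure.volume_eq_prod, ← Measure.prod_restrict]
        exact lintegral_prod_symm' _ ((hmF.comp measurable_snd).mul hmG)
    _ ≤ ∫⁻ y in Set.Icc (-1 : ℝ) 1, F y * (K₁ + K₁ + (K₁ + K₁)) := by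
        refine lintegral_mono fun y => ?_
        have hGy : Measurable (G y) :=
          ((hms _ _).add (hms _ _)).add ((hms _ _).add (hms _ _))
        rw [lintegral_const_mul _ hGy]
        refine mul_le_mul' le_rfl ?_
        exact lintegral_four_powSing_le h₁ _ _ _ _
    _ ≤ _ := by
        rw [lintegral_mul_const _ hmF]
        refine mul_le_mul' ?_ le_rfl
        exact lintegral_four_powSing_le h₂ _ _ _ _

lemma abs_le_rho (p : Heis) : |p.1| ≤ rho p ∧ |p.2.1| ≤ rho p := by
  have key : ∀ a b t : ℝ, |a| ≤ ((a ^ 2 + b) ^ 2 + t ^ 2) ^ ((1 : ℝ) / 4) ∨ b < 0 := by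
    intro a b t
    by_cases hb : b < 0
    · exact Or.inr hb
    left
    push Not at hb
    have h4 : |a| ^ 4 ≤ (a ^ 2 + b) ^ 2 + t ^ 2 := by
      have : |a| ^ 4 = (a ^ 2) ^ 2 := by rw [← sq_abs a]; ring
      rw [this]
      nlinarith [sq_nonneg a, sq_nonneg t, mul_nonneg (sq_nonneg a) hb]
    calc |a| = (|a| ^ 4) ^ ((1 : ℝ) / 4) := by
          rw [← Real.rpow_natCast, ← Real.rpow_mul (abs_nonneg a)]; norm_num
      _ ≤ _ := Real.rpow_le_rpow (by positivity) h4 (by norm_num)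
  constructor
  · exact (key p.1 (p.2.1 ^ 2) p.2.2).resolve_right (not_lt.2 (sq_nonneg _))
  · have := (key p.2.1 (p.1 ^ 2) p.2.2).resolve_right (not_lt.2 (sq_nonneg _))
    rwa [add_comm (p.2.1 ^ 2)] at this

lemma ofReal_inv_rho_le {r : ℝ} (hr : 0 < r) (y ξ : Heis) :
    ENNReal.ofReal (rho (Hmul (Hinv y) (Hdil r ξ)))⁻¹ ≤
      (ENNReal.ofReal r)⁻¹ *
        (powSing (1 / 3) (y.1 / r) ξ.1 * powSing (2 / 3) (y.2.1 / r) ξ.2.1) := by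
  obtain ⟨h1, h2⟩ := abs_le_rho (Hmul (Hinv y) (Hdil r ξ))
  set R := rho (Hmul (Hinv y) (Hdil r ξ))
  have scale : ∀ a x : ℝ, |-a + r * x| ≤ R → |x - a / r| ≤ R / r := by
    intro a x h
    rw [le_div_iff₀ hr]
    have : |x - a / r| * r = |-a + r * x| := by
      rw [← abs_of_pos hr, ← abs_mul, abs_of_pos hr]
      congr 1
      field_simp
      ring
    rwa [this]
  replace h1 := scale _ _ h1
  replace h2 := scale _ _ h2
  rcases le_or_gt R 0 with hR | hR
  · rw [ENNReal.ofReal_of_nonpos (inv_nonpos.2 hR)]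
    exact zero_le
  · have hRr : 0 < R / r := div_pos hR hr
    have hq0 : ENNReal.ofReal (R / r) ≠ 0 := (ENNReal.ofReal_pos.2 hRr).ne'
    have e : R⁻¹ = r⁻¹ * (R / r)⁻¹ := by field_simp
    rw [e, ENNReal.ofReal_mul (inv_nonneg.2 hr.le), ENNReal.ofReal_inv_of_pos hr,
      ENNReal.ofReal_inv_of_pos hRr]
    refine mul_le_mul' le_rfl ?_
    calc (ENNReal.ofReal (R / r))⁻¹
        = ENNReal.ofReal (R / r) ^ (-(1 / 3) : ℝ) * ENNReal.ofReal (R / r) ^ (-(2 / 3) : ℝ) := by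
          rw [← ENNReal.rpow_add _ _ hq0 ENNReal.ofReal_ne_top, ← ENNReal.rpow_neg_one]
          norm_num
      _ ≤ _ := mul_le_mul' (rpow_neg_anti (by norm_num) (ENNReal.ofReal_le_ofReal h1))
          (rpow_neg_anti (by norm_num) (ENNReal.ofReal_le_ofReal h2))

lemma hasFDerivAt_gcap {v : ℝ × ℝ} (hv : v ∈ unitDisk) :
    HasFDerivAt gcap
      ((-(2 * (v.1 ^ 2 + v.2 ^ 2) / gcap v)) •
        (v.1 • ContinuousLinearMap.fst ℝ ℝ ℝ + v.2 • ContinuousLinearMap.snd ℝ ℝ ℝ)) v := by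
  simp only [unitDisk, Set.mem_ofPred_eq] at hv
  have hpos : 0 < 1 - (v.1 ^ 2 + v.2 ^ 2) ^ 2 := by nlinarith [sq_nonneg v.1, sq_nonneg v.2]
  have h1 : HasFDerivAt (fun w : ℝ × ℝ => w.1) (ContinuousLinearMap.fst ℝ ℝ ℝ) v :=
    hasFDerivAt_fst
  have h2 : HasFDerivAt (fun w : ℝ × ℝ => w.2) (ContinuousLinearMap.snd ℝ ℝ ℝ) v :=
    hasFDerivAt_snd
  have h := (((((h1.pow 2).add (h2.pow 2)).pow 2).const_sub 1).sqrt hpos.ne')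
  refine h.congr_fderiv ?_
  have hg : √(1 - (v.1 ^ 2 + v.2 ^ 2) ^ 2) ≠ 0 := (Real.sqrt_pos.2 hpos).ne'
  ext <;> simp [gcap] <;> field_simp

/-- The rotational term of the area density vanishes on graphs of radial functions, so the
density of both hemispheres has at worst an inverse square root singularity at the equator. -/
lemma sqrt_density_le {ε : ℝ} (hε : ε ^ 2 = 1) {v : ℝ × ℝ} (hv : v ∈ unitDisk) {p q : ℝ}
    (hp : p = ε * (-(2 * (v.1 ^ 2 + v.2 ^ 2) / gcap v) * v.1))
    (hq : q = ε * (-(2 * (v.1 ^ 2 + v.2 ^ 2) / gcap v) * v.2)) :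
    ENNReal.ofReal √((p - v.2) ^ 2 + (q + v.1) ^ 2) ≤
      2 * ENNReal.ofReal (1 - (v.1 ^ 2 + v.2 ^ 2)) ^ (-(1 / 2) : ℝ) := by
  simp only [unitDisk, Set.mem_ofPred_eq] at hv
  set s := v.1 ^ 2 + v.2 ^ 2 with hs
  have hs0 : 0 ≤ s := by positivity
  have hpos : 0 < 1 - s ^ 2 := by nlinarith
  have hg2 : gcap v ^ 2 = 1 - s ^ 2 := Real.sq_sqrt hpos.le
  have hval : (p - v.2) ^ 2 + (q + v.1) ^ 2 = 4 * s ^ 3 / (1 - s ^ 2) + s := by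
    have : (p - v.2) ^ 2 + (q + v.1) ^ 2 = ε ^ 2 * (4 * s ^ 2 * s / gcap v ^ 2) + s := by
      rw [hp, hq]
      have hexp : (ε * (-(2 * s / gcap v) * v.1) - v.2) ^ 2 +
          (ε * (-(2 * s / gcap v) * v.2) + v.1) ^ 2 =
          ε ^ 2 * (4 * s ^ 2 * (v.1 ^ 2 + v.2 ^ 2) / gcap v ^ 2) + (v.1 ^ 2 + v.2 ^ 2) := by
        ring
      rw [hexp, ← hs]
    rw [this, hε, hg2]
    ring
  have hle : (p - v.2) ^ 2 + (q + v.1) ^ 2 ≤ 2 ^ 2 * (1 - s)⁻¹ := by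
    rw [hval]
    have h1s : 0 < 1 - s := by linarith
    have : 2 ^ 2 * (1 - s)⁻¹ - (4 * s ^ 3 / (1 - s ^ 2) + s) =
        (4 * (1 + s) - 4 * s ^ 3 - s * (1 - s ^ 2)) / (1 - s ^ 2) := by
      have h1p : 1 + s ≠ 0 := by positivity
      have e : 1 - s ^ 2 = (1 - s) * (1 + s) := by ring
      rw [e]
      field_simp
      ring
    have hnn : 0 ≤ (4 * (1 + s) - 4 * s ^ 3 - s * (1 - s ^ 2)) / (1 - s ^ 2) := by
      refine div_nonneg ?_ hpos.le
      nlinarith [mul_nonneg hs0 hpos.le]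
    linarith
  have h1s : 0 < 1 - s := by linarith
  calc ENNReal.ofReal √((p - v.2) ^ 2 + (q + v.1) ^ 2)
      ≤ ENNReal.ofReal (2 * (1 - s) ^ (-(1 / 2) : ℝ)) := by
        refine ENNReal.ofReal_le_ofReal ((Real.sqrt_le_sqrt hle).trans_eq ?_)
        rw [Real.sqrt_mul (by norm_num), Real.sqrt_sq (by norm_num), Real.sqrt_eq_rpow,
          Real.rpow_neg h1s.le, Real.inv_rpow h1s.le]
    _ = _ := by
        rw [ENNReal.ofReal_mul (by norm_num), ENNReal.ofReal_rpow_of_pos h1s]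
        norm_num

lemma ofReal_graphDens_gcap_le {v : ℝ × ℝ} (hv : v ∈ unitDisk) :
    ENNReal.ofReal (graphDens gcap v) ≤
      2 * ENNReal.ofReal (1 - (v.1 ^ 2 + v.2 ^ 2)) ^ (-(1 / 2) : ℝ) := by
  refine sqrt_density_le (ε := 1) (by norm_num) hv ?_ ?_ <;>
  · rw [(hasFDerivAt_gcap hv).fderiv]
    simp

lemma ofReal_graphDens_neg_gcap_le {v : ℝ × ℝ} (hv : v ∈ unitDisk) :
    ENNReal.ofReal (graphDens (fun w => -gcap w) v) ≤
      2 * ENNReal.ofReal (1 - (v.1 ^ 2 + v.2 ^ 2)) ^ (-(1 / 2) : ℝ) := by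
  refine sqrt_density_le (ε := -1) (by norm_num) hv ?_ ?_ <;>
  · rw [(hasFDerivAt_gcap hv).fun_neg.fderiv]
    simp

lemma measurable_graphDens (u : ℝ × ℝ → ℝ) : Measurable (graphDens u) := by
  unfold graphDens
  have h1 := measurable_fderiv_apply_const ℝ u ((1, 0) : ℝ × ℝ)
  have h2 := measurable_fderiv_apply_const ℝ u ((0, 1) : ℝ × ℝ)
  fun_prop

lemma measurable_gcap : Measurable gcap := by
  unfold gcap
  fun_prop

lemma measurable_kernel (r : ℝ) :
    Measurable fun q : Heis × Heis =>
      ENNReal.ofReal (rho (Hmul (Hinv q.2) (Hdil r q.1)))⁻¹ := by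
  unfold rho Hmul Hinv Hdil
  fun_prop

lemma measurable_kernel_left (r : ℝ) (y : Heis) :
    Measurable fun ξ : Heis => ENNReal.ofReal (rho (Hmul (Hinv y) (Hdil r ξ)))⁻¹ := by
  unfold rho Hmul Hinv Hdil
  fun_prop

lemma lintegral_graph_le {K : ENNReal}
    (hK : ∀ a b : ℝ,
      ∫⁻ v in unitDisk, ENNReal.ofReal (1 - (v.1 ^ 2 + v.2 ^ 2)) ^ (-(1 / 2) : ℝ) *
        (powSing (1 / 3) a v.1 * powSing (2 / 3) b v.2) ≤ K)
    {u h : ℝ × ℝ → ℝ} (hu : Measurable u) (hh : Measurable h)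
    (hle : ∀ v ∈ unitDisk, ENNReal.ofReal (h v) ≤
      2 * ENNReal.ofReal (1 - (v.1 ^ 2 + v.2 ^ 2)) ^ (-(1 / 2) : ℝ))
    {r : ℝ} (hr : 0 < r) (y : Heis) :
    ∫⁻ ξ, ENNReal.ofReal (rho (Hmul (Hinv y) (Hdil r ξ)))⁻¹
        ∂(Measure.map (fun v : ℝ × ℝ => (v.1, v.2, u v))
          ((volume.restrict unitDisk).withDensity fun v => ENNReal.ofReal (h v))) ≤
      2 * (ENNReal.ofReal r)⁻¹ * K := by
  have hker := measurable_kernel_left r y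
  have hmap : Measurable fun v : ℝ × ℝ => ((v.1, v.2, u v) : Heis) := by fun_prop
  rw [lintegral_map hker hmap]
  refine (lintegral_withDensity_eq_lintegral_mul _ hh.ennreal_ofReal
    (hker.comp hmap)).trans_le ?_
  have hm : Measurable fun v : ℝ × ℝ =>
      ENNReal.ofReal (1 - (v.1 ^ 2 + v.2 ^ 2)) ^ (-(1 / 2) : ℝ) *
        (powSing (1 / 3) (y.1 / r) v.1 * powSing (2 / 3) (y.2.1 / r) v.2) := by
    unfold powSing
    fun_prop
  calc _ ≤ ∫⁻ v in unitDisk, 2 * (ENNReal.ofReal r)⁻¹ *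
        (ENNReal.ofReal (1 - (v.1 ^ 2 + v.2 ^ 2)) ^ (-(1 / 2) : ℝ) *
        (powSing (1 / 3) (y.1 / r) v.1 * powSing (2 / 3) (y.2.1 / r) v.2)) := by
        refine setLIntegral_mono (hm.const_mul _) fun v hv => ?_
        refine (mul_le_mul' (hle v hv) (ofReal_inv_rho_le hr y (v.1, v.2, u v))).trans_eq ?_
        ring
    _ ≤ _ := by
        rw [lintegral_const_mul _ hm]
        exact mul_le_mul' le_rfl (hK _ _)

instance sFinite_sigmaSphere : SFinite sigmaSphere := by
  unfold sigmaSphere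
  infer_instance

lemma exists_lintegral_sigmaSphere_le :
    ∃ K : ENNReal, K ≠ ⊤ ∧ ∀ r : ℝ, 0 < r → ∀ y : Heis,
      ∫⁻ ξ, ENNReal.ofReal (rho (Hmul (Hinv y) (Hdil r ξ)))⁻¹ ∂sigmaSphere ≤
        K / ENNReal.ofReal r := by
  obtain ⟨K, hK, h⟩ := exists_lintegral_disk_le
  refine ⟨4 * K, by finiteness, fun r hr y => ?_⟩
  rw [sigmaSphere, lintegral_add_measure]
  refine (add_le_add
    (lintegral_graph_le h measurable_gcap (measurable_graphDens _)
      (fun v hv => ofReal_graphDens_gcap_le hv) hr y)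
    (lintegral_graph_le h measurable_gcap.neg (measurable_graphDens _)
      (fun v hv => ofReal_graphDens_neg_gcap_le hv) hr y)).trans_eq ?_
  rw [div_eq_mul_inv]
  ring

/-- uniformly in `y ∈ ℍ¹` and `r ≥ 1`, the average of `ρ(y⁻¹·δ_r(ξ))⁻¹` over
the Korányi unit sphere is `O(1/r)`; consequently, for `f ∈ L¹`, the spherical average over
`∂B_r` of the bound `∫ |f(y)| ρ(y⁻¹x)⁻¹ dv(y)` for `|∇_b v|` is at most `C‖f‖_{L¹}/r`. -/
theorem sphere_average_decay_one :
    ∃ C : ENNReal, C ≠ ⊤ ∧ ∀ r : ℝ, 1 ≤ r →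
      (∀ y : Heis,
        (∫⁻ ξ, ENNReal.ofReal (rho (Hmul (Hinv y) (Hdil r ξ)))⁻¹ ∂sigmaSphere)
            / sigmaSphere Set.univ
          ≤ C / ENNReal.ofReal r) ∧
      ∀ f : Heis → ℝ, Integrable f volume →
        (∫⁻ ξ, (∫⁻ y, ENNReal.ofReal |f y| *
            ENNReal.ofReal (rho (Hmul (Hinv y) (Hdil r ξ)))⁻¹) ∂sigmaSphere)
            / sigmaSphere Set.univ
          ≤ C * (∫⁻ y, ENNReal.ofReal |f y|) / ENNReal.ofReal r := by
  obtain ⟨K, hK, h⟩ := exists_lintegral_sigmaSphere_le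
  rcases eq_or_ne (sigmaSphere Set.univ) 0 with h0 | h0
  · have hz : sigmaSphere = 0 := Measure.measure_univ_eq_zero.1 h0
    exact ⟨0, by simp, fun r _ => ⟨fun y => by simp [hz], fun f _ => by simp [hz]⟩⟩
  refine ⟨K / sigmaSphere Set.univ, ENNReal.div_ne_top hK h0, fun r hr => ?_⟩
  have hr0 : 0 < r := by linarith
  refine ⟨fun y => ?_, fun f hf => ?_⟩
  · refine (ENNReal.div_le_div_right (h r hr0 y) _).trans_eq ?_
    simp only [div_eq_mul_inv]
    ring
  · have hfm : AEMeasurable (fun y => ENNReal.ofReal |f y|) volume :=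
      hf.aestronglyMeasurable.aemeasurable.abs.ennreal_ofReal
    have hle : ∫⁻ ξ, (∫⁻ y, ENNReal.ofReal |f y| *
        ENNReal.ofReal (rho (Hmul (Hinv y) (Hdil r ξ)))⁻¹) ∂sigmaSphere ≤
        (∫⁻ y, ENNReal.ofReal |f y|) * (K / ENNReal.ofReal r) := by
      rw [lintegral_lintegral_swap (hfm.comp_snd.mul (measurable_kernel r).aemeasurable)]
      rw [← lintegral_mul_const'' _ hfm]
      refine lintegral_mono fun y => ?_
      rw [lintegral_const_mul _ (measurable_kernel_left r y)]
      exact mul_le_mul' le_rfl (h r hr0 y)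
    refine (ENNReal.div_le_div_right hle _).trans_eq ?_
    simp only [div_eq_mul_inv]
    ring

end
end

section
/- On ℍ¹∖{0}, the sub-Laplacian of the function |z|²/(|z|⁴+t²) satisfies Δ_b ( |z|²/(|z|⁴+t²) ) = 4 (t² − |z|⁴) / (|z|⁴+t²)², where z = x+iy. -/
open MeasureTheory Real

noncomputable section

lemma koranyi_quartic_ne_zero {p : Heis} (hp : p ≠ (0, 0, 0)) :
    (p.1 ^ 2 + p.2.1 ^ 2) ^ 2 + p.2.2 ^ 2 ≠ 0 := by
  obtain ⟨x, y, t⟩ := p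
  intro h
  simp only at h
  have ht : t = 0 := by nlinarith [sq_nonneg (x ^ 2 + y ^ 2), sq_nonneg t]
  have hw : x ^ 2 + y ^ 2 = 0 := by nlinarith [sq_nonneg (x ^ 2 + y ^ 2), sq_nonneg t]
  have hx : x = 0 := by nlinarith [sq_nonneg x, sq_nonneg y]
  have hy : y = 0 := by nlinarith [sq_nonneg x, sq_nonneg y]
  exact hp (by rw [hx, hy, ht])

lemma fderiv_div_apply {f g : Heis → ℝ} {f' g' : Heis →L[ℝ] ℝ} {p : Heis}
    (hf : HasFDerivAt f f' p) (hg : HasFDerivAt g g' p) (h : g p ≠ 0) (v : Heis) :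
    fderiv ℝ (fun q => f q / g q) p v = (f' v * g p - f p * g' v) / g p ^ 2 := by
  have hq : HasFDerivAt (fun q => f q / g q) _ p :=
    hf.fun_mul ((hasDerivAt_inv h).comp_hasFDerivAt p hg)
  rw [hq.fderiv]
  simp
  field_simp
  ring

lemma hasFDerivAt_x (p : Heis) :
    HasFDerivAt (fun q : Heis => q.1) (ContinuousLinearMap.fst ℝ ℝ (ℝ × ℝ)) p :=
  hasFDerivAt_fst

lemma hasFDerivAt_y (p : Heis) :
    HasFDerivAt (fun q : Heis => q.2.1)
      ((ContinuousLinearMap.fst ℝ ℝ ℝ).comp (ContinuousLinearMap.snd ℝ ℝ (ℝ × ℝ))) p :=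
  hasFDerivAt_snd.fst

lemma hasFDerivAt_t (p : Heis) :
    HasFDerivAt (fun q : Heis => q.2.2)
      ((ContinuousLinearMap.snd ℝ ℝ ℝ).comp (ContinuousLinearMap.snd ℝ ℝ (ℝ × ℝ))) p :=
  hasFDerivAt_snd.snd

lemma fderiv_kernel_apply {p : Heis} (hp : p ≠ (0, 0, 0)) (v : Heis) :
    fderiv ℝ (fun q : Heis =>
      (q.1 ^ 2 + q.2.1 ^ 2) / ((q.1 ^ 2 + q.2.1 ^ 2) ^ 2 + q.2.2 ^ 2)) p v =
      ((2 * p.1 * v.1 + 2 * p.2.1 * v.2.1) * ((p.1 ^ 2 + p.2.1 ^ 2) ^ 2 + p.2.2 ^ 2) -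
        (p.1 ^ 2 + p.2.1 ^ 2) * (2 * (p.1 ^ 2 + p.2.1 ^ 2) *
          (2 * p.1 * v.1 + 2 * p.2.1 * v.2.1) + 2 * p.2.2 * v.2.2)) /
        ((p.1 ^ 2 + p.2.1 ^ 2) ^ 2 + p.2.2 ^ 2) ^ 2 := by
  have hw := ((hasFDerivAt_x p).pow 2).fun_add ((hasFDerivAt_y p).pow 2)
  have hD := (hw.pow 2).fun_add ((hasFDerivAt_t p).pow 2)
  rw [fderiv_div_apply hw hD (koranyi_quartic_ne_zero hp)]
  simp
  ring

lemma eventually_ne_origin {p : Heis} (hp : p ≠ (0, 0, 0)) :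
    ∀ᶠ q in nhds p, q ≠ ((0, 0, 0) : Heis) :=
  isOpen_ne.mem_nhds hp

lemma Xd_kernel_eventuallyEq {p : Heis} (hp : p ≠ (0, 0, 0)) :
    Xd (fun q => (q.1 ^ 2 + q.2.1 ^ 2) / ((q.1 ^ 2 + q.2.1 ^ 2) ^ 2 + q.2.2 ^ 2)) =ᶠ[nhds p]
      fun q => (2 * q.1 * (q.2.2 ^ 2 - (q.1 ^ 2 + q.2.1 ^ 2) ^ 2) -
        4 * q.2.1 * (q.2.2 * (q.1 ^ 2 + q.2.1 ^ 2))) /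
        ((q.1 ^ 2 + q.2.1 ^ 2) ^ 2 + q.2.2 ^ 2) ^ 2 := by
  filter_upwards [eventually_ne_origin hp] with q hq
  rw [Xd, fderiv_kernel_apply hq]
  ring

lemma Yd_kernel_eventuallyEq {p : Heis} (hp : p ≠ (0, 0, 0)) :
    Yd (fun q => (q.1 ^ 2 + q.2.1 ^ 2) / ((q.1 ^ 2 + q.2.1 ^ 2) ^ 2 + q.2.2 ^ 2)) =ᶠ[nhds p]
      fun q => (2 * q.2.1 * (q.2.2 ^ 2 - (q.1 ^ 2 + q.2.1 ^ 2) ^ 2) +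
        4 * q.1 * (q.2.2 * (q.1 ^ 2 + q.2.1 ^ 2))) /
        ((q.1 ^ 2 + q.2.1 ^ 2) ^ 2 + q.2.2 ^ 2) ^ 2 := by
  filter_upwards [eventually_ne_origin hp] with q hq
  rw [Yd, fderiv_kernel_apply hq]
  ring

/-- `Δ_b (|z|²/(|z|⁴+t²)) = 4(t²−|z|⁴)/(|z|⁴+t²)²` on `ℍ¹∖{0}`. -/
theorem subLap_kernel (p : Heis) (hp : p ≠ (0, 0, 0)) :
    subLap (fun q => (q.1 ^ 2 + q.2.1 ^ 2) / ((q.1 ^ 2 + q.2.1 ^ 2) ^ 2 + q.2.2 ^ 2)) p =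
      4 * (p.2.2 ^ 2 - (p.1 ^ 2 + p.2.1 ^ 2) ^ 2) /
        ((p.1 ^ 2 + p.2.1 ^ 2) ^ 2 + p.2.2 ^ 2) ^ 2 := by
  have hw := ((hasFDerivAt_x p).pow 2).fun_add ((hasFDerivAt_y p).pow 2)
  have hD := (hw.pow 2).fun_add ((hasFDerivAt_t p).pow 2)
  have hd := ((hasFDerivAt_t p).pow 2).fun_sub (hw.pow 2)
  have hm := (hasFDerivAt_t p).fun_mul hw
  have hX := (((hasFDerivAt_x p).const_mul 2).fun_mul hd).fun_sub
    (((hasFDerivAt_y p).const_mul 4).fun_mul hm)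
  have hY := (((hasFDerivAt_y p).const_mul 2).fun_mul hd).fun_add
    (((hasFDerivAt_x p).const_mul 4).fun_mul hm)
  have h0 := koranyi_quartic_ne_zero hp
  rw [subLap, Xd, Yd, (Xd_kernel_eventuallyEq hp).fderiv_eq,
    (Yd_kernel_eventuallyEq hp).fderiv_eq,
    fderiv_div_apply hX (hD.pow 2) (pow_ne_zero 2 h0),
    fderiv_div_apply hY (hD.pow 2) (pow_ne_zero 2 h0)]
  simp
  field_simp
  ring

end
end
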